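/- With X, Y, f, e, M, M' as in the context: there exists a constant C > 0 such that for all N ≥ 0, M'(N) ≤ M(N + C) + C and M(N) ≤ M'(N + C) + C (inequalities in [0,∞]). -/

import Mathlib

open Filter ENNReal

/-- The Gromov product `(a·b)_e` in a metric space. -/
noncomputable def gromovProd {X : Type*} [MetricSpace X] (e a b : X) : ℝ :=
  (dist a e + dist b e - dist a b) / 2

/-- `X` is `(δ)`-hyperbolic. -/
def IsDeltaHyperbolic (X : Type*) [MetricSpace X] (δ : ℝ) : Prop :=
  ∀ e a b c : X, gromovProd e a b ≥ min (gromovProd e a c) (gromovProd e b c) - δ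

/-- `γ : ℝ → X` restricts to a geodesic from `a` to `b` on `[0, dist a b]`. -/
def IsGeodesicFromTo {X : Type*} [MetricSpace X] (γ : ℝ → X) (a b : X) : Prop :=
  γ 0 = a ∧ γ (dist a b) = b ∧
    ∀ s ∈ Set.Icc (0 : ℝ) (dist a b), ∀ t ∈ Set.Icc (0 : ℝ) (dist a b),
      dist (γ s) (γ t) = |s - t|

/-- Every pair of points of `X` is joined by a geodesic. -/
def IsGeodesicSpace (X : Type*) [MetricSpace X] : Prop :=
  ∀ a b : X, ∃ γ : ℝ → X, IsGeodesicFromTo γ a b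

/-- `f` is metrically proper (relative to the basepoint `e`). -/
def MetricallyProper {Y X : Type*} [MetricSpace Y] [MetricSpace X]
    (f : Y → X) (e : Y) : Prop :=
  ∀ R : ℝ, ∃ S : ℝ, ∀ y : Y, dist (f y) (f e) ≤ R → dist y e ≤ S

/-- `M(N)`: the infimum in `[0,∞]` of the Gromov products `(f x · f y)_{f e}`
over pairs `x, y ∈ Y` with `(x·y)_e ≥ N`.  The infimum of the empty set is `∞`. -/
noncomputable def Mfun {Y X : Type*} [MetricSpace Y] [MetricSpace X]
    (f : Y → X) (e : Y) (N : ℝ) : ℝ≥0∞ :=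
  sInf {p : ℝ≥0∞ | ∃ x y : Y, N ≤ gromovProd e x y ∧
    p = ENNReal.ofReal (gromovProd (f e) (f x) (f y))}

/-- `M'(N)`: the infimum in `[0,∞]` of the distances from `f e` to the images of
geodesics in `X` from `f x` to `f y`, over pairs `x, y ∈ Y` joined by some geodesic
in `Y` whose image avoids the open ball of radius `N` about `e`. -/
noncomputable def M'fun {Y X : Type*} [MetricSpace Y] [MetricSpace X]
    (f : Y → X) (e : Y) (N : ℝ) : ℝ≥0∞ :=
  sInf {p : ℝ≥0∞ | ∃ x y : Y,
    (∃ γY : ℝ → Y, IsGeodesicFromTo γY x y ∧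
      ∀ s ∈ Set.Icc (0 : ℝ) (dist x y), N ≤ dist e (γY s)) ∧
    ∃ γX : ℝ → X, IsGeodesicFromTo γX (f x) (f y) ∧
      p = EMetric.infEdist (f e) (γX '' Set.Icc (0 : ℝ) (dist (f x) (f y)))}

theorem gromovProd_nonneg {X : Type*} [MetricSpace X] (e a b : X) : 0 ≤ gromovProd e a b := by
  unfold gromovProd
  linarith [dist_triangle_right a b e]

/-- The distance from `e` to a point of a geodesic is at least the Gromov product at `e` of its
endpoints. -/
theorem IsGeodesicFromTo.gromovProd_le_dist {X : Type*} [MetricSpace X] {γ : ℝ → X} {a b : X}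
    (hγ : IsGeodesicFromTo γ a b) (e : X) {s : ℝ} (hs : s ∈ Set.Icc 0 (dist a b)) :
    gromovProd e a b ≤ dist e (γ s) := by
  obtain ⟨h0, h1, h⟩ := hγ
  have ha := h 0 ⟨le_rfl, dist_nonneg⟩ s hs
  have hb := h (dist a b) ⟨dist_nonneg, le_rfl⟩ s hs
  rw [h0, zero_sub, abs_neg, abs_of_nonneg hs.1] at ha
  rw [h1, abs_of_nonneg (sub_nonneg.2 hs.2)] at hb
  unfold gromovProd
  linarith [dist_triangle a (γ s) e, dist_triangle b (γ s) e, dist_comm e (γ s)]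

/-- In a `(δ)`-hyperbolic space, a geodesic comes within `2 * δ` of realising the Gromov product
of its endpoints as a distance from the basepoint. -/
theorem IsGeodesicFromTo.exists_dist_le_gromovProd_add {X : Type*} [MetricSpace X] {δ : ℝ}
    {γ : ℝ → X} {a b : X} (hγ : IsGeodesicFromTo γ a b) (hX : IsDeltaHyperbolic X δ) (e : X) :
    ∃ t ∈ Set.Icc 0 (dist a b), dist e (γ t) ≤ gromovProd e a b + 2 * δ := by
  obtain ⟨h0, h1, h⟩ := hγ
  have ht : gromovProd a e b ∈ Set.Icc 0 (dist a b) := by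
    refine ⟨gromovProd_nonneg _ _ _, ?_⟩
    unfold gromovProd
    linarith [dist_triangle e b a, dist_comm a b]
  refine ⟨_, ht, ?_⟩
  have ha := h 0 ⟨le_rfl, dist_nonneg⟩ _ ht
  have hb := h (dist a b) ⟨dist_nonneg, le_rfl⟩ _ ht
  rw [h0, zero_sub, abs_neg, abs_of_nonneg ht.1] at ha
  rw [h1, abs_of_nonneg (sub_nonneg.2 ht.2)] at hb
  have key := hX e a b (γ (gromovProd a e b))
  generalize γ (gromovProd a e b) = p at *
  unfold gromovProd at *
  rcases min_choice ((dist a e + dist p e - dist a p) / 2)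
    ((dist b e + dist p e - dist b p) / 2) with hm | hm <;> rw [hm] at key <;>
    linarith [dist_comm e p, dist_comm e a, dist_comm e b, dist_comm b a]

theorem stmt2 {Y X : Type*} [MetricSpace Y] [MetricSpace X]
    [ProperSpace Y] [ProperSpace X]
    (hgeoY : IsGeodesicSpace Y) (hgeoX : IsGeodesicSpace X)
    (δY δX : ℝ) (hδY : 0 ≤ δY) (hδX : 0 ≤ δX)
    (hhypY : IsDeltaHyperbolic Y δY) (hhypX : IsDeltaHyperbolic X δX)
    (f : Y → X) (e : Y) (hf : MetricallyProper f e) :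
    ∃ C : ℝ, 0 < C ∧ ∀ N : ℝ, 0 ≤ N →
      M'fun f e N ≤ Mfun f e (N + C) + ENNReal.ofReal C ∧
      Mfun f e N ≤ M'fun f e (N + C) + ENNReal.ofReal C := by
  refine ⟨2 * δX + 2 * δY + 1, by linarith, fun N hN => ⟨?_, ?_⟩⟩
  · unfold M'fun Mfun
    rw [ENNReal.sInf_add]
    refine le_iInf₂ ?_
    rintro _ ⟨x, y, hxy, rfl⟩
    obtain ⟨γY, hγY⟩ := hgeoY x y
    obtain ⟨γX, hγX⟩ := hgeoX (f x) (f y)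
    obtain ⟨t, ht, htd⟩ := hγX.exists_dist_le_gromovProd_add hhypX (f e)
    refine sInf_le_of_le ⟨x, y, ⟨γY, hγY, fun s hs => ?_⟩, γX, hγX, rfl⟩ ?_
    · linarith [hγY.gromovProd_le_dist e hs]
    · refine (Metric.infEDist_le_edist_of_mem (Set.mem_image_of_mem γX ht)).trans ?_
      rw [edist_dist, ← ENNReal.ofReal_add (gromovProd_nonneg _ _ _) (by linarith)]
      exact ENNReal.ofReal_le_ofReal (by linarith)
  · refine le_trans ?_ le_self_add
    unfold M'fun Mfun
    refine le_sInf ?_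
    rintro _ ⟨x, y, ⟨γY, hγY, hfar⟩, γX, hγX, rfl⟩
    obtain ⟨t, ht, htd⟩ := hγY.exists_dist_le_gromovProd_add hhypY e
    refine sInf_le_of_le ⟨x, y, by linarith [hfar t ht], rfl⟩ ?_
    refine Metric.le_infEDist.2 ?_
    rintro _ ⟨s, hs, rfl⟩
    rw [edist_dist]
    exact ENNReal.ofReal_le_ofReal (hγX.gromovProd_le_dist (f e) hs)
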